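/- Let T be real and let s₁, s₂ be complex numbers with Re(s₂) > Re(s₁) > 0. Then the triple series ∑_{m,k,c ≥ 1} τ(m,2T) r_c(m) / ( k^{1+2s₁} c^{1+2s₁} m^{1−s₁+s₂} ) converges absolutely and equals F(s₁,s₂). -/

import Mathlib

/-- `e(x) = exp(2πix)`. -/
noncomputable def e (x : ℂ) : ℂ := Complex.exp (2 * Real.pi * Complex.I * x)

/-- `τ(m,2T) = ∑_{ab=m} (a/b)^{2iT}`, summing over ordered factorizations `m = a·b`. -/
noncomputable def tauT (m : ℕ) (T : ℝ) : ℂ :=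
  ∑ d ∈ m.divisors, (((d : ℂ)) / ((m / d : ℕ) : ℂ)) ^ (2 * (T : ℂ) * Complex.I)

/-- The Ramanujan sum `r_c(m) = ∑_{h mod c, (h,c)=1} e(mh/c)`. -/
noncomputable def ramanujanSum (c m : ℕ) : ℂ :=
  ∑ h ∈ (Finset.range c).filter (fun h => Nat.Coprime h c),
    e ((m : ℂ) * (h : ℂ) / (c : ℂ))

/-- `F(s₁,s₂) = ζ(1+s₁+s₂+2iT)ζ(1+s₁+s₂−2iT)ζ(1−s₁+s₂+2iT)ζ(1−s₁+s₂−2iT)/ζ(2+2s₂)`. -/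
noncomputable def F (T : ℝ) (s₁ s₂ : ℂ) : ℂ :=
  riemannZeta (1 + s₁ + s₂ + 2 * T * Complex.I) *
    riemannZeta (1 + s₁ + s₂ - 2 * T * Complex.I) *
    riemannZeta (1 - s₁ + s₂ + 2 * T * Complex.I) *
    riemannZeta (1 - s₁ + s₂ - 2 * T * Complex.I) / riemannZeta (2 + 2 * s₂)

/-- Reorganising a convergent sum along the fibres of `φ`, when each fibre is in bijection with a
finite set. -/
theorem HasSum.sum_fiber_of_bijOn {A B J : Type*} {f : A → ℂ} {a : ℂ} (hf : HasSum f a)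
    (φ : A → B) (i : A → J) (t : B → Finset J) (g : B → J → ℂ)
    (hbij : ∀ b, Set.BijOn i (φ ⁻¹' {b}) (t b)) (hfg : ∀ x, f x = g (φ x) (i x)) :
    HasSum (fun b => ∑ j ∈ t b, g b j) a := by
  have h1 : HasSum (f ∘ Equiv.sigmaFiberEquiv φ) a := (Equiv.hasSum_iff _).2 hf
  refine h1.sigma fun b => ?_
  let E : {x // φ x = b} ≃ (t b : Set J) := (hbij b).equiv i
  have h2 : HasSum (fun j : (t b : Set J) => g b j) (∑ j ∈ t b, g b j) :=
    (t b).hasSum (g b)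
  have h3 := (Equiv.hasSum_iff E).2 h2
  refine h3.congr_fun ?_
  rintro ⟨x, rfl⟩
  exact hfg x

theorem HasSum.mul_complex {A B : Type*} {f : A → ℂ} {g : B → ℂ} {a b : ℂ}
    (hf : HasSum f a) (hg : HasSum g b) :
    HasSum (fun x : A × B => f x.1 * g x.2) (a * b) :=
  hf.mul hg (summable_mul_of_summable_norm hf.summable.norm hg.summable.norm)

theorem log_pnat_mul (x y : ℕ+) :
    Complex.log (((x * y : ℕ+) : ℕ) : ℂ) =
      Complex.log ((x : ℕ) : ℂ) + Complex.log ((y : ℕ) : ℂ) := by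
  rw [← Complex.natCast_log, ← Complex.natCast_log, ← Complex.natCast_log, PNat.mul_coe,
    Nat.cast_mul, Real.log_mul (by simp) (by simp), Complex.ofReal_add]

theorem hasSum_pnat_of_LSeriesSummable {f : ℕ → ℂ} {s : ℂ} (h : LSeriesSummable f s) :
    HasSum (fun n : ℕ+ => f n * Complex.exp (-s * Complex.log ((n : ℕ) : ℂ))) (LSeries f s) := by
  have h1 := (PNat.coe_injective.hasSum_iff (f := LSeries.term f s) (a := LSeries f s) (by
    intro x hx
    have : x = 0 := by
      by_contra h0
      exact hx ⟨⟨x, Nat.pos_of_ne_zero h0⟩, rfl⟩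
    simp [this])).2 h.hasSum
  refine h1.congr_fun ?_
  intro n
  simp only [Function.comp, LSeries.term_def, n.ne_zero, if_false]
  rw [Complex.cpow_def_of_ne_zero (by simp), div_eq_mul_inv, ← Complex.exp_neg]
  congr 2
  ring

theorem hasSum_pnat_riemannZeta {s : ℂ} (hs : 1 < s.re) :
    HasSum (fun n : ℕ+ => Complex.exp (-s * Complex.log ((n : ℕ) : ℂ))) (riemannZeta s) := by
  have h := hasSum_pnat_of_LSeriesSummable (LSeriesSummable_one_iff.2 hs)
  rw [LSeries_one_eq_riemannZeta hs] at h
  simpa using h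

theorem hasSum_pnat_moebius {s : ℂ} (hs : 1 < s.re) :
    HasSum (fun n : ℕ+ => (ArithmeticFunction.moebius n : ℂ) *
      Complex.exp (-s * Complex.log ((n : ℕ) : ℂ))) (riemannZeta s)⁻¹ := by
  have h := hasSum_pnat_of_LSeriesSummable (ArithmeticFunction.LSeriesSummable_moebius_iff.2 hs)
  have h2 := ArithmeticFunction.LSeries_zeta_mul_Lseries_moebius hs
  rw [ArithmeticFunction.LSeries_zeta_eq_riemannZeta hs] at h2
  rwa [eq_inv_of_mul_eq_one_right h2] at h

theorem sum_range_e (c m : ℕ) (hc : 0 < c) :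
    ∑ h ∈ Finset.range c, e ((m : ℂ) * (h : ℂ) / (c : ℂ)) = if c ∣ m then (c : ℂ) else 0 := by
  have hp := Complex.isPrimitiveRoot_exp c hc.ne'
  set ξ := Complex.exp (2 * Real.pi * Complex.I / c) with hξ
  have h1 : ∀ h : ℕ, e ((m : ℂ) * (h : ℂ) / (c : ℂ)) = (ξ ^ m) ^ h := by
    intro h
    rw [hξ, e, ← Complex.exp_nat_mul, ← Complex.exp_nat_mul]
    congr 1
    ring
  simp only [h1]
  split_ifs with hd
  · rw [(hp.pow_eq_one_iff_dvd m).2 hd]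
    simp
  · have hne : ξ ^ m ≠ 1 := fun h => hd ((hp.pow_eq_one_iff_dvd m).1 h)
    rw [geom_sum_eq hne, ← pow_mul, mul_comm, pow_mul, hp.pow_eq_one, one_pow, sub_self, zero_div]

theorem sum_divisors_ramanujanSum (c m : ℕ) (hc : 0 < c) :
    ∑ d ∈ c.divisors, ramanujanSum d m = if c ∣ m then (c : ℂ) else 0 := by
  rw [← sum_range_e c m hc]
  simp only [ramanujanSum]
  rw [Finset.sum_sigma']
  refine Finset.sum_bij' (fun x _ => x.2 * (c / x.1))
    (fun h _ => ⟨c / Nat.gcd h c, h / Nat.gcd h c⟩) ?_ ?_ ?_ ?_ ?_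
  · rintro ⟨d, h⟩ hx
    simp only [Finset.mem_sigma, Nat.mem_divisors, Finset.mem_filter, Finset.mem_range] at hx ⊢
    obtain ⟨⟨⟨q, rfl⟩, -⟩, hlt, -⟩ := hx
    have hd : 0 < d := by omega
    rw [Nat.mul_div_cancel_left _ hd]
    exact Nat.mul_lt_mul_of_pos_right hlt (Nat.pos_of_mul_pos_left hc)
  · intro h hh
    have hg : 0 < Nat.gcd h c := Nat.gcd_pos_of_pos_right _ hc
    simp only [Finset.mem_sigma, Nat.mem_divisors, Finset.mem_filter, Finset.mem_range] at hh ⊢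
    exact ⟨⟨Nat.div_dvd_of_dvd (Nat.gcd_dvd_right h c), hc.ne'⟩,
      Nat.div_lt_div_of_lt_of_dvd (Nat.gcd_dvd_right h c) hh, Nat.coprime_div_gcd_div_gcd hg⟩
  · rintro ⟨d, h⟩ hx
    simp only [Finset.mem_sigma, Nat.mem_divisors, Finset.mem_filter, Finset.mem_range] at hx
    obtain ⟨⟨⟨q, rfl⟩, -⟩, hlt, hcop⟩ := hx
    have hd : 0 < d := by omega
    have hq : 0 < q := Nat.pos_of_mul_pos_left hc
    simp only [Nat.mul_div_cancel_left _ hd, Nat.gcd_mul_right, hcop.gcd_eq_one, one_mul,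
      Nat.mul_div_cancel _ hq]
  · intro h hh
    have hg : 0 < Nat.gcd h c := Nat.gcd_pos_of_pos_right _ hc
    simp only
    rw [Nat.div_div_self (Nat.gcd_dvd_right h c) hc.ne',
      Nat.div_mul_cancel (Nat.gcd_dvd_left h c)]
  · rintro ⟨d, h⟩ hx
    simp only [Finset.mem_sigma, Nat.mem_divisors, Finset.mem_filter, Finset.mem_range] at hx
    obtain ⟨⟨⟨q, rfl⟩, -⟩, hlt, hcop⟩ := hx
    have hd : 0 < d := by omega
    have hq : 0 < q := Nat.pos_of_mul_pos_left hc
    have hd' : (d : ℂ) ≠ 0 := by exact_mod_cast hd.ne'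
    have hq' : (q : ℂ) ≠ 0 := by exact_mod_cast hq.ne'
    simp only [Nat.mul_div_cancel_left _ hd]
    congr 1
    push_cast
    field_simp

theorem ramanujanSum_eq_sum_moebius (c m : ℕ) (hc : 0 < c) :
    ramanujanSum c m = ∑ d ∈ (Nat.gcd m c).divisors,
      (d : ℂ) * (ArithmeticFunction.moebius (c / d) : ℂ) := by
  have h := (ArithmeticFunction.sum_eq_iff_sum_mul_moebius_eq
    (f := fun d => ramanujanSum d m) (g := fun n => if n ∣ m then (n : ℂ) else 0)).1
    (fun n hn => sum_divisors_ramanujanSum n m hn) c hc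
  rw [← h, Nat.sum_divisorsAntidiagonal'
    (fun a b => (ArithmeticFunction.moebius a : ℂ) * if b ∣ m then (b : ℂ) else 0)]
  have hg : (Nat.gcd m c).divisors = c.divisors.filter (· ∣ m) := by
    ext d
    simp only [Nat.mem_divisors, Finset.mem_filter, Nat.dvd_gcd_iff, ne_eq, Nat.gcd_eq_zero_iff]
    have := hc.ne'
    tauto
  rw [hg, Finset.sum_filter]
  refine Finset.sum_congr rfl fun d _ => ?_
  split_ifs <;> ring

/-- Positive quadruples `(x, y, z, t)` with `y` and `z` coprime parametrise the solutions of
`d n = p q` through `d = x y`, `n = z t`, `p = x z`, `q = y t`. -/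
theorem bijOn_coprime_quadruples (b : ℕ+ × ℕ+) :
    Set.BijOn
      (fun w : {w : (ℕ+ × ℕ+) × (ℕ+ × ℕ+) // Nat.Coprime (w.1.2 : ℕ) (w.2.1 : ℕ)} =>
        ((w.1.1.1 * w.1.2.1 : ℕ+) : ℕ))
      ((fun w : {w : (ℕ+ × ℕ+) × (ℕ+ × ℕ+) // Nat.Coprime (w.1.2 : ℕ) (w.2.1 : ℕ)} =>
        (w.1.1.1 * w.1.1.2, w.1.2.1 * w.1.2.2)) ⁻¹' {b})
      (((b.1 * b.2 : ℕ+) : ℕ).divisors : Finset ℕ) := by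
  obtain ⟨d, n⟩ := b
  refine ⟨?_, ?_, ?_⟩
  · rintro ⟨⟨⟨x, y⟩, z, t⟩, hc⟩ hw
    simp only [Set.mem_preimage, Set.mem_singleton_iff, Prod.mk.injEq] at hw
    obtain ⟨rfl, rfl⟩ := hw
    simp only [Finset.mem_coe, Nat.mem_divisors, PNat.mul_coe]
    refine ⟨⟨y * t, by ring⟩, by simp⟩
  · rintro ⟨⟨⟨x, y⟩, z, t⟩, hc⟩ hw ⟨⟨⟨x', y'⟩, z', t'⟩, hc'⟩ hw' hxz
    simp only [Set.mem_preimage, Set.mem_singleton_iff, Prod.mk.injEq] at hw hw' hc hc'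
    obtain ⟨rfl, rfl⟩ := hw
    obtain ⟨h1, h2⟩ := hw'
    simp only [PNat.coe_inj] at hxz
    have hx : x = x' := by
      have e1 : Nat.gcd ((x * y : ℕ+) : ℕ) ((x * z : ℕ+) : ℕ) = x := by
        rw [PNat.mul_coe, PNat.mul_coe, Nat.gcd_mul_left, hc.gcd_eq_one, mul_one]
      have e2 : Nat.gcd ((x' * y' : ℕ+) : ℕ) ((x' * z' : ℕ+) : ℕ) = x' := by
        rw [PNat.mul_coe, PNat.mul_coe, Nat.gcd_mul_left, hc'.gcd_eq_one, mul_one]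
      rw [h1, ← hxz, e1] at e2
      exact PNat.coe_inj.1 e2
    subst hx
    have hy := mul_left_cancel h1
    have hz := mul_left_cancel hxz
    subst hy hz
    have ht := mul_left_cancel h2
    subst ht
    rfl
  · intro p hp
    simp only [Finset.mem_coe, Nat.mem_divisors, PNat.mul_coe] at hp
    obtain ⟨hp, -⟩ := hp
    have hd := d.pos
    have hn := n.pos
    have hp0 : 0 < p := Nat.pos_of_dvd_of_pos hp (Nat.mul_pos hd hn)
    have hg : 0 < Nat.gcd d p := Nat.gcd_pos_of_pos_right _ hp0
    obtain ⟨x, y, z, hx, hcop, hdx, hpx⟩ :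
        ∃ x y z : ℕ, 0 < x ∧ Nat.Coprime y z ∧ (d : ℕ) = x * y ∧ p = x * z :=
      ⟨Nat.gcd d p, d / Nat.gcd d p, p / Nat.gcd d p, hg, Nat.coprime_div_gcd_div_gcd hg,
        (Nat.mul_div_cancel' (Nat.gcd_dvd_left _ _)).symm,
        (Nat.mul_div_cancel' (Nat.gcd_dvd_right _ _)).symm⟩
    have hz : z ∣ n := by
      rw [hdx, hpx, mul_assoc] at hp
      exact hcop.symm.dvd_of_dvd_mul_left (Nat.dvd_of_mul_dvd_mul_left hx hp)
    obtain ⟨t, ht⟩ := hz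
    have hy0 : 0 < y := Nat.pos_of_ne_zero fun h => by simp [h] at hdx
    have hz0 : 0 < z := Nat.pos_of_ne_zero fun h => by simp [h] at ht
    have ht0 : 0 < t := Nat.pos_of_ne_zero fun h => by simp [h] at ht
    refine ⟨⟨⟨⟨⟨x, hx⟩, ⟨y, hy0⟩⟩, ⟨z, hz0⟩, ⟨t, ht0⟩⟩, hcop⟩, ?_, hpx.symm⟩
    simp only [Set.mem_preimage, Set.mem_singleton_iff, Prod.mk.injEq]
    exact ⟨PNat.eq hdx.symm, PNat.eq ht.symm⟩

/-- Extracting the greatest common divisor of the two middle entries of a positive quadruple. -/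
theorem bijective_gcd_mul_coprime : Function.Bijective
    (fun w : ℕ+ × {w : (ℕ+ × ℕ+) × (ℕ+ × ℕ+) // Nat.Coprime (w.1.2 : ℕ) (w.2.1 : ℕ)} =>
      (((w.2.1.1.1, w.1 * w.2.1.1.2), (w.1 * w.2.1.2.1, w.2.1.2.2)) :
        (ℕ+ × ℕ+) × (ℕ+ × ℕ+))) := by
  constructor
  · rintro ⟨g, ⟨⟨x, y⟩, z, t⟩, hc⟩ ⟨g', ⟨⟨x', y'⟩, z', t'⟩, hc'⟩ h
    simp only [Prod.mk.injEq] at h hc hc'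
    obtain ⟨⟨rfl, hy⟩, hz, rfl⟩ := h
    have hg : g = g' := by
      have e1 : Nat.gcd ((g * y : ℕ+) : ℕ) ((g * z : ℕ+) : ℕ) = g := by
        rw [PNat.mul_coe, PNat.mul_coe, Nat.gcd_mul_left, hc.gcd_eq_one, mul_one]
      have e2 : Nat.gcd ((g' * y' : ℕ+) : ℕ) ((g' * z' : ℕ+) : ℕ) = g' := by
        rw [PNat.mul_coe, PNat.mul_coe, Nat.gcd_mul_left, hc'.gcd_eq_one, mul_one]
      rw [← hy, ← hz, e1] at e2
      exact PNat.coe_inj.1 e2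
    subst hg
    have hy := mul_left_cancel hy
    have hz := mul_left_cancel hz
    subst hy hz
    rfl
  · rintro ⟨⟨x, y⟩, z, t⟩
    have hg : 0 < Nat.gcd y z := Nat.gcd_pos_of_pos_right _ z.pos
    refine ⟨⟨⟨Nat.gcd y z, hg⟩, ⟨⟨⟨x, ⟨y / Nat.gcd y z,
      Nat.div_pos (Nat.gcd_le_left _ y.pos) hg⟩⟩, ⟨z / Nat.gcd y z,
      Nat.div_pos (Nat.gcd_le_right _ z.pos) hg⟩, t⟩, Nat.coprime_div_gcd_div_gcd hg⟩⟩, ?_⟩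
    simp only [Prod.mk.injEq, true_and, and_true]
    exact ⟨PNat.eq (Nat.mul_div_cancel' (Nat.gcd_dvd_left _ _)),
      PNat.eq (Nat.mul_div_cancel' (Nat.gcd_dvd_right _ _))⟩

theorem div_cpow_eq_exp (x y : ℕ+) (z : ℂ) :
    (((x : ℕ) : ℂ) / ((y : ℕ) : ℂ)) ^ z =
      Complex.exp (z * Complex.log ((x : ℕ) : ℂ) - z * Complex.log ((y : ℕ) : ℂ)) := by
  have hx : (0 : ℝ) < (x : ℕ) := by exact_mod_cast x.pos
  have hy : (0 : ℝ) < (y : ℕ) := by exact_mod_cast y.pos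
  rw [Complex.cpow_def_of_ne_zero (by simp), ← Complex.natCast_log, ← Complex.natCast_log,
    ← Complex.ofReal_natCast, ← Complex.ofReal_natCast, ← Complex.ofReal_div,
    ← Complex.ofReal_log (by positivity), Real.log_div hx.ne' hy.ne', Complex.ofReal_sub]
  congr 1
  ring

theorem hasSum_tauT_mul (T : ℝ) {u s : ℂ} (hu : 1 < u.re) (hs : 1 < s.re) :
    HasSum (fun b : ℕ+ × ℕ+ => tauT ((b.1 * b.2 : ℕ+) : ℕ) T *
        Complex.exp (-u * Complex.log ((b.1 : ℕ) : ℂ) - s * Complex.log ((b.2 : ℕ) : ℂ)))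
      (riemannZeta (u + 2 * T * Complex.I) * riemannZeta (u - 2 * T * Complex.I) *
        riemannZeta (s + 2 * T * Complex.I) * riemannZeta (s - 2 * T * Complex.I) /
        riemannZeta (u + s)) := by
  set α : ℂ := 2 * T * Complex.I with hα
  have hα0 : α.re = 0 := by simp [hα]
  have hus : 1 < (u + s).re := by rw [Complex.add_re]; linarith
  have hζ : riemannZeta (u + s) ≠ 0 := riemannZeta_ne_zero_of_one_lt_re hus
  have hq := ((hasSum_pnat_riemannZeta (s := u - α) (by simp [hα0, hu])).mul_complex
    (hasSum_pnat_riemannZeta (s := u + α) (by simp [hα0, hu]))).mul_complex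
    ((hasSum_pnat_riemannZeta (s := s - α) (by simp [hα0, hs])).mul_complex
    (hasSum_pnat_riemannZeta (s := s + α) (by simp [hα0, hs])))
  obtain ⟨S, hsub⟩ := hq.summable.subtype
    {w : (ℕ+ × ℕ+) × (ℕ+ × ℕ+) | Nat.Coprime (w.1.2 : ℕ) (w.2.1 : ℕ)}
  have hprod := (hasSum_pnat_riemannZeta hus).mul_complex hsub
  have hq' := (Equiv.hasSum_iff (Equiv.ofBijective _ bijective_gcd_mul_coprime)).2 hq
  have hval := hprod.unique (hq'.congr_fun (by
    rintro ⟨g, ⟨⟨x, y⟩, z, t⟩, hc⟩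
    simp only [Function.comp, Equiv.ofBijective_apply, log_pnat_mul, ← Complex.exp_add]
    congr 1
    ring))
  have hSval : S = riemannZeta (u + α) * riemannZeta (u - α) *
        riemannZeta (s + α) * riemannZeta (s - α) / riemannZeta (u + s) := by
    rw [eq_div_iff hζ, mul_comm, hval]
    ring
  rw [← hSval]
  have hfib := hsub.sum_fiber_of_bijOn _ _ _
    (fun (b : ℕ+ × ℕ+) (j : ℕ) => ((j : ℂ) / ((((b.1 * b.2 : ℕ+) : ℕ) / j : ℕ) : ℂ)) ^ α *
        Complex.exp (-u * Complex.log ((b.1 : ℕ) : ℂ) - s * Complex.log ((b.2 : ℕ) : ℂ)))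
    bijOn_coprime_quadruples ?_
  · refine hfib.congr_fun fun b => ?_
    rw [tauT, Finset.sum_mul]
  · rintro ⟨⟨⟨x, y⟩, z, t⟩, hc⟩
    have hdiv : (((x * y * (z * t) : ℕ+) : ℕ) / ((x * z : ℕ+) : ℕ)) = ((y * t : ℕ+) : ℕ) := by
      apply Nat.div_eq_of_eq_mul_right (x * z).pos
      simp only [PNat.mul_coe]
      ring
    simp only [Function.comp]
    rw [hdiv, div_cpow_eq_exp]
    simp only [log_pnat_mul, ← Complex.exp_add]
    congr 1
    ring

theorem bijOn_common_divisors (b : ℕ+ × ℕ+ × ℕ+) :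
    Set.BijOn (fun w : (ℕ+ × ℕ+) × (ℕ+ × ℕ+) => (w.2.1 : ℕ))
      ((fun w : (ℕ+ × ℕ+) × (ℕ+ × ℕ+) => (w.2.1 * w.2.2, w.1.1, w.2.1 * w.1.2)) ⁻¹' {b})
      ((Nat.gcd b.1 b.2.2).divisors : Finset ℕ) := by
  obtain ⟨m, k, c⟩ := b
  refine ⟨?_, ?_, ?_⟩
  · rintro ⟨⟨k', e'⟩, d, n⟩ hw
    simp only [Set.mem_preimage, Set.mem_singleton_iff, Prod.mk.injEq] at hw
    obtain ⟨rfl, rfl, rfl⟩ := hw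
    simp [Nat.dvd_gcd_iff]
  · rintro ⟨⟨k, e⟩, d, n⟩ hw ⟨⟨k', e'⟩, d', n'⟩ hw' h
    simp only [Set.mem_preimage, Set.mem_singleton_iff, Prod.mk.injEq] at hw hw'
    obtain ⟨rfl, rfl, rfl⟩ := hw
    obtain ⟨h1, rfl, h2⟩ := hw'
    simp only [PNat.coe_inj] at h
    subst h
    have h1 := mul_left_cancel h1
    have h2 := mul_left_cancel h2
    subst h1 h2
    rfl
  · intro d hd
    simp only [Finset.mem_coe, Nat.mem_divisors, Nat.dvd_gcd_iff] at hd
    obtain ⟨⟨⟨n, hn⟩, ⟨e', he⟩⟩, -⟩ := hd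
    have hm := m.pos
    have hc := c.pos
    rw [hn] at hm
    rw [he] at hc
    refine ⟨⟨⟨k, ⟨e', Nat.pos_of_mul_pos_left hc⟩⟩, ⟨d, Nat.pos_of_mul_pos_right hc⟩,
      ⟨n, Nat.pos_of_mul_pos_left hm⟩⟩, ?_, rfl⟩
    simp only [Set.mem_preimage, Set.mem_singleton_iff, Prod.mk.injEq, true_and]
    exact ⟨PNat.eq hn.symm, PNat.eq he.symm⟩

theorem hasSum_triple_series (T : ℝ) (s₁ s₂ : ℂ) (h₁ : 0 < s₁.re) (h₂ : s₁.re < s₂.re) :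
    HasSum (fun p : ℕ+ × ℕ+ × ℕ+ =>
      tauT (p.1 : ℕ) T * ramanujanSum (p.2.2 : ℕ) (p.1 : ℕ) /
        (((p.2.1 : ℕ) : ℂ) ^ (1 + 2 * s₁) * ((p.2.2 : ℕ) : ℂ) ^ (1 + 2 * s₁) *
          ((p.1 : ℕ) : ℂ) ^ (1 - s₁ + s₂))) (F T s₁ s₂) := by
  have hw : 1 < (1 + 2 * s₁).re := by simp; linarith
  have hu : 1 < (1 + s₁ + s₂).re := by simp; linarith
  have hs : 1 < (1 - s₁ + s₂).re := by simp; linarith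
  have hζ := riemannZeta_ne_zero_of_one_lt_re hw
  have h := ((hasSum_pnat_riemannZeta hw).mul_complex (hasSum_pnat_moebius hw)).mul_complex
    (hasSum_tauT_mul T hu hs)
  rw [mul_inv_cancel₀ hζ, one_mul,
    show 1 + s₁ + s₂ + (1 - s₁ + s₂) = 2 + 2 * s₂ by ring] at h
  have hfib := h.sum_fiber_of_bijOn _ _ _
    (fun (b : ℕ+ × ℕ+ × ℕ+) (j : ℕ) => (j : ℂ) * (ArithmeticFunction.moebius ((b.2.2 : ℕ) / j) : ℂ) *
      (tauT (b.1 : ℕ) T * Complex.exp (-(1 + 2 * s₁) * Complex.log ((b.2.1 : ℕ) : ℂ) -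
        (1 + 2 * s₁) * Complex.log ((b.2.2 : ℕ) : ℂ) -
        (1 - s₁ + s₂) * Complex.log ((b.1 : ℕ) : ℂ))))
    bijOn_common_divisors ?_
  · refine hfib.congr_fun fun b => ?_
    rw [← Finset.sum_mul, ← ramanujanSum_eq_sum_moebius _ _ b.2.2.pos,
      Complex.cpow_def_of_ne_zero (by simp), Complex.cpow_def_of_ne_zero (by simp),
      Complex.cpow_def_of_ne_zero (by simp), div_eq_mul_inv, ← Complex.exp_add,
      ← Complex.exp_add, ← Complex.exp_neg, mul_comm (tauT _ _), mul_assoc]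
    congr 3
    ring
  · rintro ⟨⟨k, e'⟩, d, n⟩
    have hdiv : ((d * e' : ℕ+) : ℕ) / (d : ℕ) = e' := by
      rw [PNat.mul_coe, Nat.mul_div_cancel_left _ d.pos]
    have hd : ((d : ℕ) : ℂ) = Complex.exp (Complex.log ((d : ℕ) : ℂ)) :=
      (Complex.exp_log (by simp)).symm
    simp only
    rw [hdiv]
    conv_rhs => rw [hd]
    simp only [log_pnat_mul]
    have hexp : Complex.exp (-(1 + 2 * s₁) * Complex.log ((k : ℕ) : ℂ)) *
        Complex.exp (-(1 + 2 * s₁) * Complex.log ((e' : ℕ) : ℂ)) *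
        Complex.exp (-(1 + s₁ + s₂) * Complex.log ((d : ℕ) : ℂ) -
          (1 - s₁ + s₂) * Complex.log ((n : ℕ) : ℂ)) =
        Complex.exp (Complex.log ((d : ℕ) : ℂ)) *
        Complex.exp (-(1 + 2 * s₁) * Complex.log ((k : ℕ) : ℂ) -
          (1 + 2 * s₁) * (Complex.log ((d : ℕ) : ℂ) + Complex.log ((e' : ℕ) : ℂ)) -
          (1 - s₁ + s₂) * (Complex.log ((d : ℕ) : ℂ) + Complex.log ((n : ℕ) : ℂ))) := by
      simp only [← Complex.exp_add]
      congr 1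
      ring
    linear_combination (ArithmeticFunction.moebius (e' : ℕ) : ℂ) *
      tauT ((d * n : ℕ+) : ℕ) T * hexp

/-- Evaluation of the triple Dirichlet series
`∑_{m,k,c ≥ 1} τ(m,2T) r_c(m) / (k^{1+2s₁} c^{1+2s₁} m^{1−s₁+s₂}) = F(s₁,s₂)`. -/
theorem triple_series_eval (T : ℝ) (s₁ s₂ : ℂ) (h₁ : 0 < s₁.re) (h₂ : s₁.re < s₂.re) :
    Summable (fun p : ℕ+ × ℕ+ × ℕ+ =>
      tauT (p.1 : ℕ) T * ramanujanSum (p.2.2 : ℕ) (p.1 : ℕ) /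
        (((p.2.1 : ℕ) : ℂ) ^ (1 + 2 * s₁) * ((p.2.2 : ℕ) : ℂ) ^ (1 + 2 * s₁) *
          ((p.1 : ℕ) : ℂ) ^ (1 - s₁ + s₂))) ∧
    ∑' p : ℕ+ × ℕ+ × ℕ+,
        tauT (p.1 : ℕ) T * ramanujanSum (p.2.2 : ℕ) (p.1 : ℕ) /
          (((p.2.1 : ℕ) : ℂ) ^ (1 + 2 * s₁) * ((p.2.2 : ℕ) : ℂ) ^ (1 + 2 * s₁) *
            ((p.1 : ℕ) : ℂ) ^ (1 - s₁ + s₂))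
      = F T s₁ s₂ := by
  have h := hasSum_triple_series T s₁ s₂ h₁ h₂
  exact ⟨h.summable, h.tsum_eq⟩
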